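/- Let k ≥ 2 and suppose ⟨L_k, L_{k−1}⟩₁ ≠ 0. If a₁, a₂ ∈ ℂ and q is a polynomial with deg q ≤ k−2 such that a₁·L_k + a₂·L_{k−1} = T(q), then a₁ = a₂ = 0. Consequently, the linear map ϱ_k which sends an element a₁·L_k + a₂·L_{k−1} of span{L_k, L_{k−1}} to the unique polynomial R of degree ≤ 1 in the decomposition a₁L_k + a₂L_{k−1} = T(q) + R (with deg q ≤ k−2, deg R ≤ 1) is a linear isomorphism onto the space of polynomials of degree ≤ 1. -/

import Mathlib

open MeasureTheory Polynomial Set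

noncomputable section

/-- The weight `w(x) = e^{−Mx/2}·x^{(M−N−1)/2}·(t−x)^{−1/2}` on `(0,∞)`,
using the principal branch of the complex power. -/
def wC (M N : ℕ) (t : ℂ) (x : ℝ) : ℂ :=
  Complex.exp (-(M : ℂ) * x / 2) * (x : ℂ) ^ (((((M : ℝ) - N - 1) / 2 : ℝ)) : ℂ) *
    (t - x) ^ (-(1 / 2) : ℂ)

/-- The Laguerre weight `w₀(x) = x^{M−N}·e^{−Mx}`. -/
def w0R (M N : ℕ) (x : ℝ) : ℝ := x ^ (M - N) * Real.exp (-(M : ℝ) * x)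

/-- The skew product `⟨f,g⟩₁ = ∫₀^∞∫₀^∞ (1/2)·sgn(x−y)·f(x)·g(y)·w(x)·w(y) dy dx`. -/
def skew1 (M N : ℕ) (t : ℂ) (f g : Polynomial ℂ) : ℂ :=
  ∫ x in Ioi (0 : ℝ), ∫ y in Ioi (0 : ℝ),
    ((Real.sign (x - y) : ℝ) : ℂ) / 2 * f.eval (x : ℂ) * g.eval (y : ℂ) *
      wC M N t x * wC M N t y

/-- The inner product `⟨f,g⟩₂ = ∫₀^∞ f(x)·g(x)·w₀(x) dx`. -/
def inner2C (M N : ℕ) (f g : Polynomial ℂ) : ℂ :=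
  ∫ x in Ioi (0 : ℝ), f.eval (x : ℂ) * g.eval (x : ℂ) * (w0R M N x : ℂ)

/-- `IsLag M N L` says that `L n` is the monic degree-`n` orthogonal polynomial for the
weight `w₀` (the rescaled Laguerre polynomial). -/
def IsLag (M N : ℕ) (L : ℕ → Polynomial ℂ) : Prop :=
  ∀ n, (L n).Monic ∧ (L n).natDegree = n ∧
    ∀ j, j < n → inner2C M N (L n) (Polynomial.X ^ j) = 0

/-- The operator `T(q)(x) = x(t−x)q′(x) +
[(t−2x) − (M/2)x(t−x) + ((M−N−1)/2)(t−x) + x/2]·q(x)`,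
i.e. formally `T(q) = (d/dx)(q·x·(t−x)·w)/w`. -/
def Tq (M N : ℕ) (t : ℂ) (q : Polynomial ℂ) : Polynomial ℂ :=
  Polynomial.X * (Polynomial.C t - Polynomial.X) * Polynomial.derivative q +
    ((Polynomial.C t - 2 * Polynomial.X)
        - Polynomial.C ((M : ℂ) / 2) * (Polynomial.X * (Polynomial.C t - Polynomial.X))
        + Polynomial.C (((M : ℂ) - N - 1) / 2) * (Polynomial.C t - Polynomial.X)
        + Polynomial.C (1 / 2) * Polynomial.X) * q

/-- `ε(f)(x) = ∫₀^∞ (1/2)·sgn(x−y)·f(y) dy`. -/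
def epsC (f : ℝ → ℂ) (x : ℝ) : ℂ :=
  ∫ y in Ioi (0 : ℝ), ((Real.sign (x - y) : ℝ) : ℂ) / 2 * f y

/-- The squared norm `h_{n,0} = ∫₀^∞ L_n(x)²·w₀(x) dx`. -/
def hC (M N : ℕ) (L : ℕ → Polynomial ℂ) (n : ℕ) : ℂ :=
  ∫ x in Ioi (0 : ℝ), (L n).eval (x : ℂ) ^ 2 * (w0R M N x : ℂ)

end

theorem sub_ofReal_mem_slitPlane {t : ℂ} (ht : t.im ≠ 0) (x : ℝ) :
    t - (x : ℂ) ∈ Complex.slitPlane := by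
  rw [Complex.mem_slitPlane_iff]
  right
  simpa using ht

theorem hasDerivAt_wC (M N : ℕ) {t : ℂ} (ht : t.im ≠ 0) {x : ℝ} (hx : 0 < x) :
    HasDerivAt (wC M N t)
      ((-(M : ℂ) / 2 + ((M : ℂ) - N - 1) / 2 / x + 1 / 2 / (t - x)) * wC M N t x) x := by
  have hx0 : (x : ℂ) ≠ 0 := by exact_mod_cast hx.ne'
  have hs := sub_ofReal_mem_slitPlane ht x
  have ht0 : t - (x : ℂ) ≠ 0 := Complex.slitPlane_ne_zero hs
  have h1 : HasDerivAt (fun z : ℂ => Complex.exp (-(M : ℂ) * z / 2))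
      (Complex.exp (-(M : ℂ) * x / 2) * (-(M : ℂ) * 1 / 2)) x :=
    (((hasDerivAt_id (x : ℂ)).const_mul (-(M : ℂ))).div_const 2).cexp
  have h2 := (hasDerivAt_id (x : ℂ)).cpow_const
    (c := (((((M : ℝ) - N - 1) / 2 : ℝ)) : ℂ)) (Complex.ofReal_mem_slitPlane.2 hx)
  have h3 := ((hasDerivAt_id (x : ℂ)).const_sub t).cpow_const (c := (-(1 / 2) : ℂ)) hs
  refine ((h1.mul h2).mul h3).comp_ofReal.congr_deriv ?_
  simp only [wC, id, Complex.cpow_sub _ _ hx0, Complex.cpow_sub _ _ ht0, Complex.cpow_one,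
    Pi.mul_apply]
  push_cast
  field_simp

theorem norm_wC_le (M N : ℕ) {t : ℂ} (ht : t.im ≠ 0) {x : ℝ} (hx : 0 < x) :
    ‖wC M N t x‖ ≤
      |t.im| ^ (-(1 / 2) : ℝ) * (x ^ (((M : ℝ) - N - 1) / 2) * Real.exp (-((M : ℝ) / 2) * x)) := by
  have ht0 : t - (x : ℂ) ≠ 0 := Complex.slitPlane_ne_zero (sub_ofReal_mem_slitPlane ht x)
  have h1 : ‖Complex.exp (-(M : ℂ) * x / 2)‖ = Real.exp (-((M : ℝ) / 2) * x) := by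
    rw [show -(M : ℂ) * x / 2 = ((-((M : ℝ) / 2) * x : ℝ) : ℂ) by push_cast; ring,
      Complex.norm_exp_ofReal]
  have h2 : ‖(t - (x : ℂ)) ^ (-(1 / 2) : ℂ)‖ ≤ |t.im| ^ (-(1 / 2) : ℝ) := by
    rw [show (-(1 / 2) : ℂ) = ((-(1 / 2) : ℝ) : ℂ) by push_cast; rfl,
      Complex.norm_cpow_of_ne_zero ht0, Complex.ofReal_re, Complex.ofReal_im, mul_zero,
      Real.exp_zero, div_one]
    refine Real.rpow_le_rpow_of_nonpos (abs_pos.2 ht) ?_ (by norm_num)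
    simpa using Complex.abs_im_le_norm (t - (x : ℂ))
  rw [wC, norm_mul, norm_mul, h1, Complex.norm_cpow_eq_rpow_re_of_pos hx, Complex.ofReal_re,
    mul_comm, mul_comm (Real.exp _)]
  gcongr

theorem integrableOn_eval_mul_wC {M N : ℕ} (hNM : N < M) {t : ℂ} (ht : t.im ≠ 0) (p : ℂ[X]) :
    IntegrableOn (fun x : ℝ => p.eval (x : ℂ) * wC M N t x) (Ioi 0) := by
  induction p using Polynomial.induction_on' with
  | add p q hp hq =>
    simp only [eval_add, add_mul]
    exact hp.add hq
  | monomial n a =>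
    have hM : (0 : ℝ) < M := by exact_mod_cast (Nat.zero_le N).trans_lt hNM
    have hs : (0 : ℝ) ≤ ((M : ℝ) - N - 1) / 2 := by
      have : (N : ℝ) + 1 ≤ M := by exact_mod_cast hNM
      linarith
    have hn : (0 : ℝ) ≤ n := n.cast_nonneg
    have key := (integrableOn_rpow_mul_exp_neg_mul_rpow (p := 1) (b := (M : ℝ) / 2)
      (s := n + ((M : ℝ) - N - 1) / 2) (by linarith) one_pos (by positivity)).const_mul
      (‖a‖ * |t.im| ^ (-(1 / 2) : ℝ))
    refine Integrable.mono' key ?_ ?_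
    · refine ContinuousOn.aestronglyMeasurable (fun x hx => ?_) measurableSet_Ioi
      refine ContinuousAt.continuousWithinAt
        (ContinuousAt.mul ?_ (hasDerivAt_wC M N ht hx).continuousAt)
      exact ((monomial n a).continuous.comp Complex.continuous_ofReal).continuousAt
    · filter_upwards [ae_restrict_mem measurableSet_Ioi] with x hx
      have hx' : 0 < x := hx
      rw [norm_mul, eval_monomial, norm_mul, norm_pow, Complex.norm_real, Real.norm_of_nonneg hx'.le,
        Real.rpow_one, Real.rpow_add hx', Real.rpow_natCast]
      calc _ ≤ ‖a‖ * x ^ n * (|t.im| ^ (-(1 / 2) : ℝ) *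
            (x ^ (((M : ℝ) - N - 1) / 2) * Real.exp (-((M : ℝ) / 2) * x))) := by
            gcongr
            exact norm_wC_le M N ht hx'
        _ = _ := by ring

/-- `q(x)·x·(t-x)·w(x)` is a primitive of `T(q)·w` on `(0,∞)`. -/
theorem hasDerivAt_eval_mul_wC (M N : ℕ) {t : ℂ} (ht : t.im ≠ 0) (q : ℂ[X]) {x : ℝ} (hx : 0 < x) :
    HasDerivAt (fun y : ℝ => (q * (X * (C t - X))).eval (y : ℂ) * wC M N t y)
      ((Tq M N t q).eval (x : ℂ) * wC M N t x) x := by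
  have hx0 : (x : ℂ) ≠ 0 := by exact_mod_cast hx.ne'
  have ht0 : t - (x : ℂ) ≠ 0 := Complex.slitPlane_ne_zero (sub_ofReal_mem_slitPlane ht x)
  refine (((q * (X * (C t - X))).hasDerivAt (x : ℂ)).comp_ofReal.mul
    (hasDerivAt_wC M N ht hx)).congr_deriv ?_
  simp only [Tq, derivative_mul, derivative_sub, derivative_X, derivative_C, eval_add, eval_mul,
    eval_sub, eval_X, eval_C, eval_one, eval_ofNat, eval_zero]
  field_simp
  ring

theorem continuousWithinAt_eval_mul_wC_zero {M N : ℕ} (hNM : N < M) {t : ℂ} (ht : t.im ≠ 0)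
    (q : ℂ[X]) :
    ContinuousWithinAt (fun y : ℝ => (q * (X * (C t - X))).eval (y : ℂ) * wC M N t y)
      (Ici 0) 0 := by
  rw [← continuousWithinAt_Ioi_iff_Ici]
  have hs : (0 : ℝ) ≤ ((M : ℝ) - N - 1) / 2 := by
    have : (N : ℝ) + 1 ≤ M := by exact_mod_cast hNM
    linarith
  have h0 : Filter.Tendsto (fun y : ℝ => (q * (X * (C t - X))).eval (y : ℂ))
      (nhdsWithin 0 (Ioi 0)) (nhds 0) := by
    have := ((q * (X * (C t - X))).continuous.comp Complex.continuous_ofReal).tendsto 0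
    simp only [Function.comp_apply, Complex.ofReal_zero, eval_mul, eval_X, zero_mul,
      mul_zero] at this
    exact (this.congr fun y => by simp).mono_left nhdsWithin_le_nhds
  have hb : Filter.IsBoundedUnder (· ≤ ·) (nhdsWithin (0 : ℝ) (Ioi 0))
      (norm ∘ wC M N t) := by
    refine Filter.isBoundedUnder_of_eventually_le (a := |t.im| ^ (-(1 / 2) : ℝ)) ?_
    filter_upwards [Ioo_mem_nhdsGT (zero_lt_one' ℝ)] with x hx
    refine (norm_wC_le M N ht hx.1).trans (mul_le_of_le_one_right (by positivity) ?_)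
    refine mul_le_one₀ (Real.rpow_le_one hx.1.le hx.2.le hs) (Real.exp_nonneg _) ?_
    rw [Real.exp_le_one_iff]
    have : 0 ≤ (M : ℝ) / 2 * x := mul_nonneg (by positivity) hx.1.le
    linarith
  simpa [ContinuousWithinAt] using h0.zero_mul_isBoundedUnder_le hb

/-- `ε` inverts differentiation: `ε(T(q)·w) = q·x·(t-x)·w`. -/
theorem epsC_Tq {M N : ℕ} (hNM : N < M) {t : ℂ} (ht : t.im ≠ 0) (q : ℂ[X]) {x : ℝ} (hx : 0 < x) :
    epsC (fun y => (Tq M N t q).eval (y : ℂ) * wC M N t y) x =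
      (q * (X * (C t - X))).eval (x : ℂ) * wC M N t x := by
  set F := fun y : ℝ => (q * (X * (C t - X))).eval (y : ℂ) * wC M N t y
  set F' := fun y : ℝ => (Tq M N t q).eval (y : ℂ) * wC M N t y
  have hd : ∀ y ∈ Ioi (0 : ℝ), HasDerivAt F (F' y) y :=
    fun y hy => hasDerivAt_eval_mul_wC M N ht q hy
  have hi' : IntegrableOn F' (Ioi 0) := integrableOn_eval_mul_wC hNM ht _
  have hlim := tendsto_zero_of_hasDerivAt_of_integrableOn_Ioi hd hi'
    (integrableOn_eval_mul_wC hNM ht _)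
  have hall : ∫ y in Ioi (0 : ℝ), F' y = 0 := by
    rw [integral_Ioi_of_hasDerivAt_of_tendsto
      (continuousWithinAt_eval_mul_wC_zero hNM ht q) hd hi' hlim]
    simp
  have hsub : Ioi x ⊆ Ioi (0 : ℝ) := Ioi_subset_Ioi hx.le
  have hupper : ∫ y in Ioi x, F' y = -F x := by
    rw [integral_Ioi_of_hasDerivAt_of_tendsto (hd x hx).continuousAt.continuousWithinAt
      (fun y hy => hd y (hsub hy)) (hi'.mono_set hsub) hlim, zero_sub]
  have hlower : ∫ y in Ioc 0 x, F' y = F x := by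
    have := setIntegral_union (μ := volume) (f := F') Ioc_disjoint_Ioi_same measurableSet_Ioi
      (hi'.mono_set ((Ioc_subset_Ioi_self : Ioc 0 x ⊆ Ioi 0))) (hi'.mono_set hsub)
    rw [Ioc_union_Ioi_eq_Ioi hx.le, hall, hupper] at this
    linear_combination -this
  have hl : ∀ y ∈ Ioo 0 x, ((Real.sign (x - y) : ℝ) : ℂ) / 2 * F' y = 1 / 2 * F' y := by
    intro y hy
    rw [Real.sign_of_pos (sub_pos.2 hy.2)]
    simp
  have hu : ∀ y ∈ Ioi x, ((Real.sign (x - y) : ℝ) : ℂ) / 2 * F' y = -(1 / 2) * F' y := by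
    intro y hy
    rw [Real.sign_of_neg (sub_neg.2 hy)]
    push_cast
    ring
  have hil := (hi'.mono_set ((Ioo_subset_Ioi_self : Ioo 0 x ⊆ Ioi 0))).const_mul (1 / 2)
  have hiu := (hi'.mono_set hsub).const_mul (-(1 / 2))
  rw [epsC, ← Ioc_union_Ioi_eq_Ioi hx.le, setIntegral_union Ioc_disjoint_Ioi_same measurableSet_Ioi
    ((integrableOn_Ioc_iff_integrableOn_Ioo (by simp)).2
      (IntegrableOn.congr_fun hil (fun y hy => (hl y hy).symm) measurableSet_Ioo))
    (IntegrableOn.congr_fun hiu (fun y hy => (hu y hy).symm) measurableSet_Ioi),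
    integral_Ioc_eq_integral_Ioo, setIntegral_congr_fun measurableSet_Ioo hl,
    setIntegral_congr_fun measurableSet_Ioi hu, integral_const_mul, integral_const_mul, hupper,
    ← integral_Ioc_eq_integral_Ioo, hlower]
  ring

theorem mul_wC_mul_wC {M N : ℕ} (hNM : N < M) {t : ℂ} (ht : t.im ≠ 0) {x : ℝ} (hx : 0 < x) :
    x * (t - x) * (wC M N t x * wC M N t x) = (w0R M N x : ℂ) := by
  have hx0 : (x : ℂ) ≠ 0 := by exact_mod_cast hx.ne'
  have ht0 : t - (x : ℂ) ≠ 0 := Complex.slitPlane_ne_zero (sub_ofReal_mem_slitPlane ht x)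
  obtain ⟨d, rfl⟩ := Nat.exists_eq_add_of_lt hNM
  have h1 : Complex.exp (-((N + d + 1 : ℕ) : ℂ) * x / 2) *
      Complex.exp (-((N + d + 1 : ℕ) : ℂ) * x / 2) =
      Complex.exp (-((N + d + 1 : ℕ) : ℂ) * x) := by
    rw [← Complex.exp_add]
    ring_nf
  have h2 : ∀ s : ℝ, s = (((N + d + 1 : ℕ) : ℝ) - N - 1) / 2 →
      (x : ℂ) ^ (s : ℂ) * (x : ℂ) ^ (s : ℂ) = (x : ℂ) ^ d := by
    rintro s rfl
    rw [← Complex.cpow_add _ _ hx0, ← Complex.cpow_natCast]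
    congr 1
    push_cast
    ring
  have h3 : (t - x) ^ (-(1 / 2) : ℂ) * (t - x) ^ (-(1 / 2) : ℂ) = (t - x)⁻¹ := by
    rw [← Complex.cpow_add _ _ ht0, ← Complex.cpow_neg_one]
    norm_num
  calc _ = x * (t - x) * ((Complex.exp (-((N + d + 1 : ℕ) : ℂ) * x / 2) *
          Complex.exp (-((N + d + 1 : ℕ) : ℂ) * x / 2)) *
        ((x : ℂ) ^ (((((N + d + 1 : ℕ) : ℝ) - N - 1) / 2 : ℝ) : ℂ) *
          (x : ℂ) ^ (((((N + d + 1 : ℕ) : ℝ) - N - 1) / 2 : ℝ) : ℂ)) *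
        ((t - x) ^ (-(1 / 2) : ℂ) * (t - x) ^ (-(1 / 2) : ℂ))) := by
        simp only [wC]
        ring
    _ = _ := by
        rw [h1, h2 _ rfl, h3, w0R, show N + d + 1 - N = d + 1 by omega]
        push_cast
        field_simp
        ring

theorem skew1_eq_integral_epsC (M N : ℕ) (t : ℂ) (f g : ℂ[X]) :
    skew1 M N t f g = ∫ x in Ioi (0 : ℝ), f.eval (x : ℂ) * wC M N t x *
      epsC (fun y => g.eval (y : ℂ) * wC M N t y) x := by
  simp only [skew1, epsC, ← integral_const_mul]
  congr! 4
  ring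

theorem skew1_Tq {M N : ℕ} (hNM : N < M) {t : ℂ} (ht : t.im ≠ 0) (f q : ℂ[X]) :
    skew1 M N t f (Tq M N t q) = inner2C M N f q := by
  rw [skew1_eq_integral_epsC, inner2C]
  refine setIntegral_congr_fun measurableSet_Ioi fun x hx => ?_
  rw [epsC_Tq hNM ht q hx, ← mul_wC_mul_wC hNM ht hx]
  simp only [eval_mul, eval_sub, eval_X, eval_C]
  ring

theorem measurable_real_sign : Measurable Real.sign :=
  Measurable.ite measurableSet_Iio measurable_const
    (Measurable.ite measurableSet_Ioi measurable_const measurable_const)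

theorem norm_sign_div_two_le (r : ℝ) : ‖((Real.sign r : ℝ) : ℂ) / 2‖ ≤ 1 := by
  rcases Real.sign_apply_eq r with h | h | h <;> rw [h] <;> norm_num

theorem integrable_skew1 {M N : ℕ} (hNM : N < M) {t : ℂ} (ht : t.im ≠ 0) (f g : ℂ[X]) :
    Integrable (Function.uncurry fun x y : ℝ => ((Real.sign (x - y) : ℝ) : ℂ) / 2 *
      f.eval (x : ℂ) * g.eval (y : ℂ) * wC M N t x * wC M N t y)
      ((volume.restrict (Ioi 0)).prod (volume.restrict (Ioi 0))) := by
  have h := Integrable.mul_prod (integrableOn_eval_mul_wC hNM ht f)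
    (integrableOn_eval_mul_wC hNM ht g)
  have hm : Measurable fun z : ℝ × ℝ => ((Real.sign (z.1 - z.2) : ℝ) : ℂ) / 2 :=
    (Complex.measurable_ofReal.comp
      (measurable_real_sign.comp (measurable_fst.sub measurable_snd))).div_const 2
  refine (h.bdd_mul (c := 1) hm.aestronglyMeasurable
    (Filter.Eventually.of_forall fun z => norm_sign_div_two_le _)).congr
    (Filter.Eventually.of_forall fun z => ?_)
  simp only [Function.uncurry]
  ring

theorem skew1_swap {M N : ℕ} (hNM : N < M) {t : ℂ} (ht : t.im ≠ 0) (f g : ℂ[X]) :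
    skew1 M N t g f = -skew1 M N t f g := by
  rw [skew1, skew1, integral_integral_swap (integrable_skew1 hNM ht f g), ← integral_neg]
  congr! 2 with x
  rw [← integral_neg]
  congr! 2 with y
  rw [← neg_sub y x, Real.sign_neg]
  push_cast
  ring

theorem skew1_self {M N : ℕ} (hNM : N < M) {t : ℂ} (ht : t.im ≠ 0) (f : ℂ[X]) :
    skew1 M N t f f = 0 :=
  self_eq_neg.1 (skew1_swap hNM ht f f)

theorem skew1_linear_right {M N : ℕ} (hNM : N < M) {t : ℂ} (ht : t.im ≠ 0) (f g h : ℂ[X])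
    (a b : ℂ) :
    skew1 M N t f (C a * g + C b * h) = a * skew1 M N t f g + b * skew1 M N t f h := by
  have hg := (integrable_skew1 hNM ht f g).const_mul a
  have hh := (integrable_skew1 hNM ht f h).const_mul b
  simp only [skew1]
  rw [integral_integral (integrable_skew1 hNM ht f g),
    integral_integral (integrable_skew1 hNM ht f h),
    integral_integral (integrable_skew1 hNM ht f (C a * g + C b * h)),
    ← integral_const_mul, ← integral_const_mul]
  refine Eq.trans ?_ (integral_add hg hh)
  congr! 2 with z
  simp only [eval_add, eval_mul, eval_C]
  ring

theorem integrableOn_eval_mul_w0R {M N : ℕ} (hNM : N < M) (p : ℂ[X]) :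
    IntegrableOn (fun x : ℝ => p.eval (x : ℂ) * (w0R M N x : ℂ)) (Ioi 0) := by
  have hM : (0 : ℝ) < M := by exact_mod_cast (Nat.zero_le N).trans_lt hNM
  induction p using Polynomial.induction_on' with
  | add p q hp hq =>
    simp only [eval_add, add_mul]
    exact hp.add hq
  | monomial n a =>
    have key := ((integrableOn_rpow_mul_exp_neg_mul_rpow (p := 1) (b := (M : ℝ))
      (s := ((n + (M - N) : ℕ) : ℝ)) (neg_one_lt_zero.trans_le (Nat.cast_nonneg _))
      one_pos hM).ofReal (𝕜 := ℂ)).const_mul a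
    refine IntegrableOn.congr_fun key (fun x _ => ?_) measurableSet_Ioi
    simp only [Real.rpow_one, Real.rpow_natCast, eval_monomial, w0R, pow_add]
    simp
    ring

theorem inner2C_eq_zero_of_natDegree_lt {M N : ℕ} (hNM : N < M) {f q : ℂ[X]} {n : ℕ}
    (hf : ∀ j, j < n → inner2C M N f (X ^ j) = 0) (hq : q.natDegree < n) :
    inner2C M N f q = 0 := by
  have hsum : ∀ x : ℝ, f.eval (x : ℂ) * q.eval (x : ℂ) * (w0R M N x : ℂ) =
      ∑ j ∈ Finset.range n,
        q.coeff j * (f.eval (x : ℂ) * (X ^ j : ℂ[X]).eval (x : ℂ) * (w0R M N x : ℂ)) := by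
    intro x
    rw [eval_eq_sum_range' hq, Finset.mul_sum, Finset.sum_mul]
    refine Finset.sum_congr rfl fun j _ => ?_
    simp only [eval_pow, eval_X]
    ring
  simp only [inner2C, hsum]
  rw [integral_finsetSum]
  · refine Finset.sum_eq_zero fun j hj => ?_
    rw [integral_const_mul]
    exact mul_eq_zero_of_right _ (hf j (Finset.mem_range.1 hj))
  · intro j _
    have := (integrableOn_eval_mul_w0R hNM (f * X ^ j)).const_mul (q.coeff j)
    simpa only [eval_mul] using this

theorem natDegree_Tq_le (M N : ℕ) (t : ℂ) (q : ℂ[X]) :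
    (Tq M N t q).natDegree ≤ q.natDegree + 2 := by
  have h1 : (X * (C t - X) : ℂ[X]).natDegree ≤ 2 := by compute_degree
  have h2 : ((C t - 2 * X) - C ((M : ℂ) / 2) * (X * (C t - X))
        + C (((M : ℂ) - N - 1) / 2) * (C t - X) + C (1 / 2) * X : ℂ[X]).natDegree ≤ 2 := by
    compute_degree
  rw [Tq]
  refine (natDegree_add_le _ _).trans (max_le ?_ ?_)
  · refine natDegree_mul_le.trans ?_
    have := natDegree_derivative_le q
    omega
  · refine natDegree_mul_le.trans ?_
    omega

theorem eq_zero_of_Tq_eq_zero {M N : ℕ} (hM : M ≠ 0) {t : ℂ} {q : ℂ[X]}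
    (h : Tq M N t q = 0) : q = 0 := by
  by_contra hq
  have h1 : (X * (C t - X) : ℂ[X]).degree ≤ 2 := by compute_degree
  have h2 : ((C t - 2 * X) - C ((M : ℂ) / 2) * (X * (C t - X))
        + C (((M : ℂ) - N - 1) / 2) * (C t - X) + C (1 / 2) * X : ℂ[X]).degree = 2 := by
    compute_degree!
  rw [Tq, add_eq_zero_iff_eq_neg'] at h
  have hdeg := congrArg degree h
  rw [degree_neg, degree_mul, degree_mul, h2] at hdeg
  have hle : 2 + q.degree ≤ 2 + q.derivative.degree :=
    hdeg.le.trans (by gcongr)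
  exact (degree_derivative_lt hq).not_ge (WithBot.le_of_add_le_add_left (by decide) hle)

/-- `Tq` as a linear map. -/
noncomputable def TqLinear (M N : ℕ) (t : ℂ) : ℂ[X] →ₗ[ℂ] ℂ[X] where
  toFun := Tq M N t
  map_add' p q := by
    simp only [Tq, derivative_add]
    ring
  map_smul' a q := by
    simp only [Tq, derivative_smul, RingHom.id_apply, mul_smul_comm, smul_add]

theorem finrank_degreeLT (n : ℕ) : Module.finrank ℂ (degreeLT ℂ n) = n := by
  simp [(degreeLTEquiv ℂ n).finrank_eq]

theorem eq_zero_of_combination_eq_Tq {M N : ℕ} (hNM : N < M) {t : ℂ} (ht : t.im ≠ 0)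
    {L : ℕ → ℂ[X]} (hL : IsLag M N L) {k : ℕ} (hk : 2 ≤ k)
    (hne : skew1 M N t (L k) (L (k - 1)) ≠ 0) {a₁ a₂ : ℂ} {q : ℂ[X]}
    (hq : q.natDegree ≤ k - 2) (h : C a₁ * L k + C a₂ * L (k - 1) = Tq M N t q) :
    a₁ = 0 ∧ a₂ = 0 := by
  have pairing : ∀ n, q.natDegree < n →
      a₁ * skew1 M N t (L n) (L k) + a₂ * skew1 M N t (L n) (L (k - 1)) = 0 := by
    intro n hn
    rw [← skew1_linear_right hNM ht, h, skew1_Tq hNM ht,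
      inner2C_eq_zero_of_natDegree_lt hNM (hL n).2.2 hn]
  have h1 := pairing k (by omega)
  have h2 := pairing (k - 1) (by omega)
  rw [skew1_self hNM ht, mul_zero, zero_add] at h1
  rw [skew1_self hNM ht, mul_zero, add_zero, skew1_swap hNM ht (L k)] at h2
  exact ⟨(mul_eq_zero.1 h2).resolve_right (neg_ne_zero.2 hne), (mul_eq_zero.1 h1).resolve_right hne⟩

/-- Let `k ≥ 2` with `⟨L_k, L_{k−1}⟩₁ ≠ 0`.  If
`a₁·L_k + a₂·L_{k−1} = T(q)` with `deg q ≤ k−2`, then `a₁ = a₂ = 0`; consequently the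
map `ϱ_k` sending `a₁·L_k + a₂·L_{k−1}` to the residual `R` of degree `≤ 1` in the
decomposition `P = T(q) + R` is a linear isomorphism onto the polynomials of degree
`≤ 1` (injectivity is the first conjunct; surjectivity is the second). -/
theorem stmt_6 (M N : ℕ) (hN : 0 < N) (hNM : N < M) (t : ℂ) (ht : t.im ≠ 0)
    (L : ℕ → Polynomial ℂ) (hL : IsLag M N L)
    (k : ℕ) (hk : 2 ≤ k) (hne : skew1 M N t (L k) (L (k - 1)) ≠ 0) :
    (∀ a₁ a₂ : ℂ, ∀ q : Polynomial ℂ, q.natDegree ≤ k - 2 →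
      Polynomial.C a₁ * L k + Polynomial.C a₂ * L (k - 1) = Tq M N t q →
      a₁ = 0 ∧ a₂ = 0) ∧
    (∀ R : Polynomial ℂ, R.natDegree ≤ 1 →
      ∃ a₁ a₂ : ℂ, ∃ q : Polynomial ℂ, q.natDegree ≤ k - 2 ∧
        Polynomial.C a₁ * L k + Polynomial.C a₂ * L (k - 1) = Tq M N t q + R) := by
  have hinj := fun a₁ a₂ q => @eq_zero_of_combination_eq_Tq M N hNM t ht L hL k hk hne a₁ a₂ q
  refine ⟨hinj, fun R hR => ?_⟩
  have hmem : ∀ {n : ℕ} {p : ℂ[X]}, p.natDegree ≤ n ↔ p ∈ degreeLT ℂ (n + 1) := by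
    intro n p
    rw [degreeLT_succ_eq_degreeLE, mem_degreeLE, natDegree_le_iff_degree_le]
  let Φ : (ℂ × ℂ) × degreeLT ℂ (k - 2 + 1) →ₗ[ℂ] ℂ[X] :=
    (((LinearMap.toSpanSingleton ℂ ℂ[X] (L k)).coprod
      (LinearMap.toSpanSingleton ℂ ℂ[X] (L (k - 1)))).coprod
        (-(TqLinear M N t).comp (degreeLT ℂ (k - 2 + 1)).subtype))
  have hΦ : ∀ v, Φ v = C v.1.1 * L k + C v.1.2 * L (k - 1) - Tq M N t v.2 := by
    intro v
    simp [Φ, TqLinear, smul_eq_C_mul, sub_eq_add_neg]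
  have hrange : ∀ v, Φ v ∈ degreeLT ℂ (k + 1) := by
    intro v
    rw [hΦ, ← hmem]
    refine (natDegree_sub_le _ _).trans (max_le ((natDegree_add_le _ _).trans (max_le ?_ ?_)) ?_)
    · exact (natDegree_C_mul_le _ _).trans (hL k).2.1.le
    · exact (natDegree_C_mul_le _ _).trans ((hL (k - 1)).2.1.le.trans (Nat.sub_le _ _))
    · have h1 := natDegree_Tq_le M N t v.2
      have h2 := hmem.2 v.2.2
      omega
  have := Module.Finite.equiv (degreeLTEquiv ℂ (k - 2 + 1)).symm
  have := Module.Finite.equiv (degreeLTEquiv ℂ (k + 1)).symm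
  have hΦinj : Function.Injective (Φ.codRestrict _ hrange) := by
    rw [← LinearMap.ker_eq_bot, LinearMap.ker_codRestrict, LinearMap.ker_eq_bot']
    rintro ⟨⟨a₁, a₂⟩, q⟩ hv
    rw [hΦ, sub_eq_zero] at hv
    obtain ⟨rfl, rfl⟩ := hinj a₁ a₂ q (hmem.2 q.2) hv
    have hq : (q : ℂ[X]) = 0 :=
      eq_zero_of_Tq_eq_zero (M := M) (N := N) (t := t) (by omega) (by simpa using hv.symm)
    simpa using hq
  obtain ⟨v, hv⟩ := (LinearMap.injective_iff_surjective_of_finrank_eq_finrank (by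
    rw [Module.finrank_prod, Module.finrank_prod, finrank_degreeLT, finrank_degreeLT,
      Module.finrank_self]
    omega)).1 hΦinj ⟨R, hmem.1 (hR.trans (by omega))⟩
  have hv' : Φ v = R := congrArg Subtype.val hv
  refine ⟨v.1.1, v.1.2, v.2, hmem.2 v.2.2, ?_⟩
  rw [hΦ] at hv'
  linear_combination hv'
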